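/- For every natural number l, the Abel-type equation with kernel K_l has at most one continuous solution: if f₁, f₂ : ℝ → ℝ are continuous on [r_m, r_M] and ∫_{r_m}^{p} f₁(r) K_l(p,r)/√(p − r) dr = ∫_{r_m}^{p} f₂(r) K_l(p,r)/√(p − r) dr for every p ∈ [r_m, r_M], then f₁ = f₂ on [r_m, r_M]. -/

import Mathlib

noncomputable section
open Real MeasureTheory

/-- Legendre polynomial of degree `l` (Rodrigues' formula). -/
def legP (l : ℕ) (x : ℝ) : ℝ :=
  (1 / (2 ^ l * Nat.factorial l : ℝ)) * iteratedDeriv l (fun y : ℝ => (y ^ 2 - 1) ^ l) x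
def Q1 (R p r : ℝ) : ℝ := 2 * π * r ^ 2 * Real.sqrt (p ^ 2 - R ^ 2) / (R * p * Real.sqrt (p + r))
def Q2 (p r : ℝ) : ℝ := 2 * π * r / p
def Q3 (R p r : ℝ) : ℝ := Real.sqrt (p ^ 2 - R ^ 2) * Real.sqrt (p + r) / p ^ 2
def Q4 (R p r : ℝ) : ℝ := R * r / p ^ 2

/-- The kernel `K_l` in its algebraic form. -/
def Kalg (R : ℝ) (l : ℕ) (p r : ℝ) : ℝ :=
  ∑ σ ∈ ({-1, 1} : Finset ℝ),
    σ ^ l * (Q1 R p r - σ * Q2 p r * Real.sqrt (p - r)) *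
      legP l (Q3 R p r * Real.sqrt (p - r) + σ * Q4 R p r)

open Polynomial in
def legU (l : ℕ) : ℝ[X] := (X ^ 2 - 1) ^ l

open Polynomial in
def legL (l : ℕ) : ℝ[X] := C (1 / (2 ^ l * Nat.factorial l : ℝ)) * derivative^[l] (legU l)

open Polynomial in
lemma iterDeriv_poly (q : ℝ[X]) (n : ℕ) (x : ℝ) :
    iteratedDeriv n (fun y => q.eval y) x = (derivative^[n] q).eval x := by
  induction n generalizing q with
  | zero => simp
  | succ n ih =>
    rw [iteratedDeriv_succ']
    have : deriv (fun y => q.eval y) = fun y => (derivative q).eval y := by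
      funext y; exact Polynomial.deriv q
    rw [this, ih, Function.iterate_succ_apply]

open Polynomial in
lemma legP_eq (l : ℕ) (x : ℝ) : legP l x = (legL l).eval x := by
  have := iterDeriv_poly (legU l) l x
  unfold legP legL
  rw [eval_mul, eval_C, ← this]
  simp [legU]

open Polynomial in
lemma legU_rec (l n : ℕ) :
    (X ^ 2 - 1) * derivative^[n+2] (legU l) + 2 * ((n:ℝ[X]) + 1) * X * derivative^[n+1] (legU l)
      + (n:ℝ[X]) * ((n:ℝ[X]) + 1) * derivative^[n] (legU l)
    = 2 * (l:ℝ[X]) * X * derivative^[n+1] (legU l)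
      + 2 * (l:ℝ[X]) * ((n:ℝ[X]) + 1) * derivative^[n] (legU l) := by
  induction n with
  | zero =>
    have h : (X ^ 2 - 1) * derivative (legU l) = 2 * (l:ℝ[X]) * X * legU l := by
      unfold legU
      rcases l with _ | l
      · simp
      · rw [derivative_pow]
        simp
        ring
    have h2 := congrArg derivative h
    simp only [derivative_mul, derivative_sub, derivative_pow, derivative_X, derivative_one,
      derivative_natCast, derivative_ofNat] at h2
    simp [Function.iterate_succ_apply'] at h2 ⊢
    simp only [show (C 2 : ℝ[X]) = 2 from rfl] at h2
    linear_combination h2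
  | succ n ih =>
    have h2 := congrArg derivative ih
    simp only [derivative_mul, derivative_sub, derivative_add, derivative_pow, derivative_X,
      derivative_one, derivative_natCast, derivative_ofNat, ← Function.iterate_succ_apply'
      (f := (derivative : ℝ[X] → ℝ[X]))] at h2
    simp at h2 ⊢
    simp only [← Function.iterate_succ_apply (f := (derivative : ℝ[X] → ℝ[X])), Nat.succ_eq_add_one, show (C 2 : ℝ[X]) = 2 from rfl] at h2 ⊢
    linear_combination h2

open Polynomial in
lemma legU_eval_rec (l n : ℕ) (x : ℝ) :
    (x ^ 2 - 1) * (derivative^[n+2] (legU l)).eval x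
      + 2 * ((n:ℝ) + 1) * x * (derivative^[n+1] (legU l)).eval x
      + (n:ℝ) * (n + 1) * (derivative^[n] (legU l)).eval x
    = 2 * (l:ℝ) * x * (derivative^[n+1] (legU l)).eval x
      + 2 * (l:ℝ) * (n + 1) * (derivative^[n] (legU l)).eval x := by
  have := congrArg (eval x) (legU_rec l n)
  simpa only [eval_add, eval_mul, eval_sub, eval_pow, eval_X, eval_one, eval_natCast,
    eval_ofNat] using this

open Polynomial in
lemma legL_ode (l : ℕ) (x : ℝ) (h0 : (legL l).eval x = 0) :
    (1 - x ^ 2) * (derivative (derivative (legL l))).eval x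
      = 2 * x * (derivative (legL l)).eval x := by
  have h := legU_eval_rec l l x
  simp only [legL, derivative_C_mul, eval_mul, eval_C,
    ← Function.iterate_succ_apply' (f := (derivative : ℝ[X] → ℝ[X]))] at h0 ⊢
  simp only [Nat.succ_eq_add_one]
  linear_combination (-(1 / (2 ^ l * Nat.factorial l : ℝ))) * h - (l:ℝ)*(l+1) * h0

open Polynomial in
lemma legL_simple (l : ℕ) (x : ℝ) (hx : x ^ 2 ≠ 1) (h0 : (legL l).eval x = 0) :
    (derivative (legL l)).eval x ≠ 0 := by
  intro h1
  have hc : (1 / (2 ^ l * Nat.factorial l : ℝ)) ≠ 0 := by positivity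
  simp only [legL, derivative_C_mul, eval_mul, eval_C, mul_eq_zero, hc, false_or,
    ← Function.iterate_succ_apply' (f := (derivative : ℝ[X] → ℝ[X])), Nat.succ_eq_add_one] at h0 h1
  have key : ∀ n, (derivative^[l+n] (legU l)).eval x = 0 ∧
      (derivative^[l+n+1] (legU l)).eval x = 0 := by
    intro n
    induction n with
    | zero => exact ⟨h0, h1⟩
    | succ n ih =>
      refine ⟨ih.2, ?_⟩
      have h := legU_eval_rec l (l+n) x
      rw [ih.1, ih.2] at h
      have h3 : (x^2 - 1) ≠ 0 := sub_ne_zero.mpr hx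
      simp only [mul_zero, add_zero, mul_eq_zero, h3, false_or] at h
      exact h
  have hm : (legU l).Monic := by
    unfold legU
    apply Monic.pow
    have : (X^2 - 1 : ℝ[X]) = X^2 - C 1 := by simp
    rw [this]
    exact monic_X_pow_sub_C 1 (by norm_num)
  have hd : (legU l).natDegree = 2 * l := by
    have : (X^2 - 1 : ℝ[X]) = X^2 - C 1 := by simp
    rw [legU, natDegree_pow, this, natDegree_X_pow_sub_C, mul_comm]
  have h := (key l).1
  rw [← two_mul] at h
  have hdeg : (derivative^[2*l] (legU l)).natDegree ≤ 0 := by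
    have := natDegree_iterate_derivative (legU l) (2*l)
    omega
  rw [eq_C_of_natDegree_le_zero hdeg, eval_C, coeff_iterate_derivative] at h
  have h4 : (legU l).coeff (0 + 2*l) = 1 := by
    rw [zero_add, ← hd]; exact hm
  rw [h4] at h
  simp [Nat.descFactorial_self, Nat.factorial_ne_zero] at h

open Polynomial in
lemma legL_parity (l : ℕ) : (legL l).comp (-X) = (-1) ^ l * legL l := by
  have h1 : (legU l).comp (-X) = legU l := by simp [legU]
  have h2 : ∀ n, (derivative^[n] (legU l)).comp (-X) = (-1)^n * derivative^[n] (legU l) := by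
    intro n
    induction n with
    | zero => simpa using h1
    | succ n ih =>
      have := congrArg derivative ih
      rw [derivative_comp] at this
      simp only [derivative_mul, derivative_neg, derivative_X, derivative_pow, derivative_one] at this
      rw [Function.iterate_succ_apply']
      simp at this
      linear_combination -this
  rw [legL, mul_comp, h2]; simp; ring

open Polynomial in
lemma legL_eval_neg (l : ℕ) (x : ℝ) : (legL l).eval (-x) = (-1) ^ l * (legL l).eval x := by
  have := congrArg (eval x) (legL_parity l)
  simpa using this

open Polynomial in
lemma legL_coeff (l k : ℕ) (h : (legL l).coeff k ≠ 0) : k % 2 = l % 2 := by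
  have := congrArg (fun q => coeff q k) (legL_parity l)
  have h2 : ((-1:ℝ[X])^l * legL l).coeff k = (-1)^l * (legL l).coeff k := by
    rw [show ((-1:ℝ[X])^l) = C ((-1)^l) by simp, coeff_C_mul]
  simp only [h2] at this
  rw [show (legL l).comp (-X) = (legL l).comp (C (-1) * X) by simp, comp_C_mul_X_coeff, mul_comm] at this
  have h3 := mul_right_cancel₀ h this
  rcases Nat.even_or_odd k with hk | hk <;> rcases Nat.even_or_odd l with hl | hl
  · rw [Nat.even_iff.mp hk, Nat.even_iff.mp hl]
  · rw [hk.neg_one_pow, hl.neg_one_pow] at h3; norm_num at h3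
  · rw [hk.neg_one_pow, hl.neg_one_pow] at h3; norm_num at h3
  · rw [Nat.odd_iff.mp hk, Nat.odd_iff.mp hl]
abbrev CC := C(ℝ × ℝ, ℝ)

def evc (x y : ℝ) : CC →+* ℝ :=
  (Pi.evalRingHom (fun _ : ℝ × ℝ => ℝ) (x, y)).comp (ContinuousMap.coeFnRingHom)

@[simp] lemma evc_apply (x y : ℝ) (φ : CC) : evc x y φ = φ (x, y) := rfl

open Polynomial in
def Good (n : ℕ) (F : ℝ → ℝ → ℝ → ℝ → ℝ) : Prop :=
  ∃ Q : Polynomial CC, ∀ x y c s, c ^ 2 + s ^ 2 = 1 →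
    F x y c s = c ^ (n % 2) * Q.eval₂ (evc x y) (s ^ 2)

open Polynomial in
lemma Good.zero (n : ℕ) : Good n (fun _ _ _ _ => 0) := ⟨0, by simp⟩

open Polynomial in
lemma Good.add {n : ℕ} {F G} (hF : Good n F) (hG : Good n G) :
    Good n (fun x y c s => F x y c s + G x y c s) := by
  obtain ⟨Q, hQ⟩ := hF
  obtain ⟨Q', hQ'⟩ := hG
  refine ⟨Q + Q', fun x y c s h => ?_⟩
  beta_reduce
  rw [hQ x y c s h, hQ' x y c s h, eval₂_add]; ring

open Polynomial in
lemma Good.smul {n : ℕ} {F} (φ : CC) (hF : Good n F) :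
    Good n (fun x y c s => φ (x, y) * F x y c s) := by
  obtain ⟨Q, hQ⟩ := hF
  refine ⟨C φ * Q, fun x y c s h => ?_⟩
  beta_reduce
  rw [hQ x y c s h, eval₂_mul, eval₂_C, evc_apply]; ring

open Polynomial in
lemma Good.s2 {n : ℕ} {F} (hF : Good n F) :
    Good n (fun x y c s => s ^ 2 * F x y c s) := by
  obtain ⟨Q, hQ⟩ := hF
  refine ⟨X * Q, fun x y c s h => ?_⟩
  beta_reduce
  rw [hQ x y c s h, eval₂_mul, eval₂_X]; ring

open Polynomial in
lemma Good.c {n : ℕ} {F} (hF : Good n F) :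
    Good (n+1) (fun x y c s => c * F x y c s) := by
  obtain ⟨Q, hQ⟩ := hF
  rcases Nat.mod_two_eq_zero_or_one n with h0 | h0
  · refine ⟨Q, fun x y c s h => ?_⟩
    beta_reduce
    rw [hQ x y c s h, h0, show (n+1) % 2 = 1 by omega]; ring
  · refine ⟨(1 - X) * Q, fun x y c s h => ?_⟩
    beta_reduce
    rw [hQ x y c s h, h0, show (n+1) % 2 = 0 by omega, eval₂_mul, eval₂_sub, eval₂_X, eval₂_one]
    rw [← h]; ring

lemma Good.congr {n m : ℕ} {F G} (hF : Good n F) (h : n % 2 = m % 2)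
    (hFG : ∀ x y c s, G x y c s = F x y c s) : Good m G := by
  obtain ⟨Q, hQ⟩ := hF
  exact ⟨Q, fun x y c s hh => by rw [hFG, hQ x y c s hh, h]⟩

lemma Good.sum {n : ℕ} (t : Finset ℕ) (F : ℕ → ℝ → ℝ → ℝ → ℝ → ℝ) (h : ∀ k ∈ t, Good n (F k)) :
    Good n (fun x y c s => ∑ k ∈ t, F k x y c s) := by
  induction t using Finset.induction_on with
  | empty => simpa using Good.zero n
  | insert a t ha ih =>
    simp only [Finset.sum_insert ha]
    exact (h a (Finset.mem_insert_self _ _)).add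
      (ih fun k hk => h k (Finset.mem_insert_of_mem hk))

def xC : CC := ⟨fun z => z.1, by fun_prop⟩
def yC : CC := ⟨fun z => z.2, by fun_prop⟩

lemma good_AB (k : ℕ) :
    Good k (fun x y c s => (x*c+y*s)^k + (x*c-y*s)^k) ∧
    Good (k+1) (fun x y c s => s * ((x*c+y*s)^k - (x*c-y*s)^k)) := by
  induction k with
  | zero =>
    refine ⟨⟨2, ?_⟩, ?_⟩
    · intro x y c s h
      norm_num [Polynomial.eval₂_ofNat]
    · simpa using Good.zero 1
  | succ k ih =>
    obtain ⟨hA, hB⟩ := ih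
    constructor
    · refine ((hA.c.smul xC).add (hB.smul yC)).congr rfl ?_
      intro x y c s
      simp [xC, yC]; ring
    · refine ((hB.c.smul xC).add (((hA.s2.smul yC)).congr (m := k+2) (by omega)
        (fun _ _ _ _ => rfl))).congr rfl ?_
      intro x y c s
      simp [xC, yC]; ring

def eform (l : ℕ) (x y c s : ℝ) : ℝ :=
  (c*y - x*s) * (legL l).eval (x*c+y*s) + (c*y+x*s) * (legL l).eval (x*c-y*s)

lemma good_eform (l : ℕ) : Good (l+1) (eform l) := by
  have h : ∀ k ∈ Finset.range ((legL l).natDegree + 1), Good (l+1) (fun x y c s =>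
      (legL l).coeff k * (y * (c * ((x*c+y*s)^k + (x*c-y*s)^k)) +
        (-x) * (s * ((x*c+y*s)^k - (x*c-y*s)^k)))) := by
    intro k _
    by_cases hk : (legL l).coeff k = 0
    · simpa [hk] using Good.zero (l+1)
    · have hp := legL_coeff l k hk
      obtain ⟨hA, hB⟩ := good_AB k
      refine (((hA.c.smul yC).add (hB.smul (-xC))).smul (ContinuousMap.const _ ((legL l).coeff k))).congr
        (by omega) ?_
      intro x y c s
      simp [xC, yC]
  refine (Good.sum _ _ h).congr rfl ?_
  intro x y c s
  simp only [eform, Polynomial.eval_eq_sum_range, Finset.mul_sum, ← Finset.sum_add_distrib]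
  refine Finset.sum_congr rfl fun k _ => ?_
  ring

open Polynomial in
lemma eform_coeffs (l : ℕ) (q : ℝ[X]) (x y : ℝ) (n : ℕ)
    (hq : ∀ c s, c ^ 2 + s ^ 2 = 1 → eform l x y c s = c ^ n * q.eval (s^2)) :
    q.coeff 0 = 2 * y * (legL l).eval x ∧
    ((legL l).eval x = 0 → x ^ 2 + y ^ 2 = 1 →
      q.coeff 1 = - x * y * (derivative (legL l)).eval x) := by
  have h0 : q.coeff 0 = 2 * y * (legL l).eval x := by
    have := hq 1 0 (by norm_num)
    simp [eform] at this
    rw [coeff_zero_eq_eval_zero, ← this]; ring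
  refine ⟨h0, fun hP hxy => ?_⟩
  set P := legL l
  have hode := legL_ode l x hP
  have hpd : ∀ (p : ℝ[X]) (u : ℝ → ℝ) (u' t : ℝ), HasDerivAt u u' t →
      HasDerivAt (fun t => p.eval (u t)) ((derivative p).eval (u t) * u') t :=
    fun p u u' t hu => (p.hasDerivAt (u t)).comp t hu
  have hA : ∀ t, HasDerivAt (fun t => eform l x y (cos t) (sin t))
     ((-sin t*y - x*cos t) * P.eval (x*cos t+y*sin t) + (cos t*y - x*sin t) *
        ((derivative P).eval (x*cos t+y*sin t) * (x * (-sin t) + y * cos t))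
      + ((-sin t*y + x*cos t) * P.eval (x*cos t-y*sin t) + (cos t*y + x*sin t) *
        ((derivative P).eval (x*cos t-y*sin t) * (x * (-sin t) - y * cos t)))) t := by
    intro t
    have hc := Real.hasDerivAt_cos t
    have hs := Real.hasDerivAt_sin t
    exact (((hc.mul_const y).sub (hs.const_mul x)).mul
      (hpd P _ _ t ((hc.const_mul x).add (hs.const_mul y)))).add
      (((hc.mul_const y).add (hs.const_mul x)).mul
      (hpd P _ _ t ((hc.const_mul x).sub (hs.const_mul y))))
  have hA2 : HasDerivAt (fun t => ((-sin t*y - x*cos t) * P.eval (x*cos t+y*sin t) + (cos t*y - x*sin t) *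
        ((derivative P).eval (x*cos t+y*sin t) * (x * (-sin t) + y * cos t))
      + ((-sin t*y + x*cos t) * P.eval (x*cos t-y*sin t) + (cos t*y + x*sin t) *
        ((derivative P).eval (x*cos t-y*sin t) * (x * (-sin t) - y * cos t)))))
      (2 * (- x * y * (derivative P).eval x)) 0 := by
    have hc := Real.hasDerivAt_cos 0
    have hs := Real.hasDerivAt_sin 0
    have hup := (hc.const_mul x).add (hs.const_mul y)
    have hum := (hc.const_mul x).sub (hs.const_mul y)
    have := ((((hs.neg.mul_const y).sub (hc.const_mul x)).mul (hpd P _ _ 0 hup)).add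
      (((hc.mul_const y).sub (hs.const_mul x)).mul ((hpd (derivative P) _ _ 0 hup).mul
        ((hs.neg.const_mul x).add (hc.const_mul y))))).add
      ((((hs.neg.mul_const y).add (hc.const_mul x)).mul (hpd P _ _ 0 hum)).add
      (((hc.mul_const y).add (hs.const_mul x)).mul ((hpd (derivative P) _ _ 0 hum).mul
        ((hs.neg.const_mul x).sub (hc.const_mul y)))))
    refine this.congr_deriv ?_
    simp [hP]
    have hy : y^2 = 1 - x^2 := by linarith
    rw [← hy] at hode
    linear_combination (2*y) * hode
  have hB : ∀ t, HasDerivAt (fun t => cos t ^ n * q.eval (sin t ^ 2))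
      ((n * cos t ^ (n-1) * (- sin t)) * q.eval (sin t ^2) +
        cos t ^ n * ((derivative q).eval (sin t ^ 2) * (2 * sin t * cos t))) t := by
    intro t
    have hc := Real.hasDerivAt_cos t
    have hs := Real.hasDerivAt_sin t
    have := (hc.pow n).mul (hpd q _ _ t (hs.pow 2))
    refine this.congr_deriv ?_
    simp
  have hB2 : HasDerivAt (fun t => ((n * cos t ^ (n-1) * (- sin t)) * q.eval (sin t ^2) +
        cos t ^ n * ((derivative q).eval (sin t ^ 2) * (2 * sin t * cos t))))
      (2 * q.coeff 1) 0 := by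
    have hc := Real.hasDerivAt_cos 0
    have hs := Real.hasDerivAt_sin 0
    have := (((((hc.pow (n-1)).const_mul (n:ℝ)).mul hs.neg).mul (hpd q _ _ 0 (hs.pow 2)))).add
      ((hc.pow n).mul ((hpd (derivative q) _ _ 0 (hs.pow 2)).mul ((hs.const_mul 2).mul hc)))
    refine this.congr_deriv ?_
    have hz : q.eval 0 = 0 := by rw [← coeff_zero_eq_eval_zero, h0, hP]; ring
    have h1 : (derivative q).eval 0 = q.coeff 1 := by
      rw [← coeff_zero_eq_eval_zero, coeff_derivative]; simp
    simp [hz, h1]; ring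
  have hEq : (fun t => eform l x y (cos t) (sin t)) = fun t => cos t ^ n * q.eval (sin t ^ 2) := by
    funext t
    exact hq _ _ (by rw [add_comm]; exact Real.sin_sq_add_cos_sq t)
  rw [hEq] at hA
  have hD := funext fun t => (hA t).unique (hB t)
  rw [hD] at hA2
  have := hA2.unique hB2
  linarith
def kr (i : ℕ) (q r : ℝ) : ℝ := (q ^ 2 - r ^ 2) ^ i / Real.sqrt (q ^ 2 - r ^ 2)

lemma kr_nonneg {i : ℕ} {q r : ℝ} (h : 0 ≤ r) (hq : r ≤ q) : 0 ≤ kr i q r := by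
  unfold kr
  have : 0 ≤ q^2 - r^2 := by nlinarith
  positivity

lemma kr_zero {i : ℕ} {q r : ℝ} (h : 0 ≤ q) (hq : q ≤ r) : kr i q r = 0 := by
  unfold kr
  rw [Real.sqrt_eq_zero_of_nonpos (by nlinarith), div_zero]

lemma kr_succ (i : ℕ) (q r : ℝ) :
    kr (i+1) q r = (q^2-r^2)^i * Real.sqrt (q^2-r^2) := by
  unfold kr
  rcases lt_or_ge 0 (q^2-r^2) with h | h
  · have h1 : 0 < Real.sqrt (q^2-r^2) := Real.sqrt_pos.mpr h
    rw [div_eq_iff h1.ne', mul_assoc, Real.mul_self_sqrt h.le, pow_succ]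
  · rw [Real.sqrt_eq_zero_of_nonpos h]; simp

lemma kr_continuous_succ (i : ℕ) : Continuous (fun z : ℝ × ℝ => kr (i+1) z.1 z.2) := by
  simp only [kr_succ]
  fun_prop

lemma kr_measurable (i : ℕ) : Measurable (fun z : ℝ × ℝ => kr i z.1 z.2) := by
  unfold kr
  fun_prop

lemma kr_hasDeriv (i : ℕ) {q r : ℝ} (h : 0 < q^2 - r^2) :
    HasDerivAt (fun q => kr (i+1) q r / (2*i+1)) (q * kr i q r) q := by
  simp only [kr_succ]
  have h1 : HasDerivAt (fun q : ℝ => q^2 - r^2) (2*q) q := by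
    simpa using ((hasDerivAt_id q).pow 2).sub_const (r^2)
  have h2 := ((h1.pow i).mul (h1.sqrt h.ne')).div_const (2*(i:ℝ)+1)
  refine h2.congr_deriv ?_
  have h3 : 0 < Real.sqrt (q^2-r^2) := Real.sqrt_pos.mpr h
  have h4 : (2*(i:ℝ)+1) ≠ 0 := by positivity
  have h5 : Real.sqrt (q^2-r^2)^2 = q^2-r^2 := Real.sq_sqrt h.le
  unfold kr
  rcases i with _ | i
  · simp; field_simp
  · simp only [Nat.add_sub_cancel]
    field_simp
    rw [h5]
    push_cast
    simp only [Pi.pow_apply]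
    ring

lemma kr_hasDeriv_r {p r : ℝ} (h : 0 < p^2 - r^2) :
    HasDerivAt (fun r => - kr 1 p r) (r * kr 0 p r) r := by
  simp only [kr_succ]
  have h1 : HasDerivAt (fun r : ℝ => p^2 - r^2) (-(2*r)) r := by
    simpa using ((hasDerivAt_id r).pow 2).const_sub (p^2)
  have h2 := (h1.sqrt h.ne').neg
  simp only [pow_zero, one_mul]
  refine h2.congr_deriv ?_
  unfold kr
  have h3 : 0 < Real.sqrt (p^2-r^2) := Real.sqrt_pos.mpr h
  field_simp

lemma kr_ftc (i : ℕ) {a r p : ℝ} (ha : 0 ≤ a) (har : a ≤ r) (hrp : r ≤ p) :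
    IntegrableOn (fun q => q * kr i q r) (Set.Ioc a p) ∧
    ∫ q in Set.Ioc a p, q * kr i q r = kr (i+1) p r / (2*i+1) := by
  have hcont : ContinuousOn (fun q => kr (i+1) q r / (2*i+1)) (Set.Icc r p) := by
    have := kr_continuous_succ i
    have h2 : Continuous (fun q => kr (i+1) q r) := this.comp (by fun_prop : Continuous fun q : ℝ => (q, r))
    exact (h2.div_const _).continuousOn
  have hder : ∀ q ∈ Set.Ioo r p, HasDerivAt (fun q => kr (i+1) q r / (2*i+1)) (q * kr i q r) q := by
    intro q hq
    exact kr_hasDeriv i (by nlinarith [hq.1])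
  have hpos : ∀ q ∈ Set.Ioo r p, 0 ≤ q * kr i q r := by
    intro q hq
    exact mul_nonneg (by linarith [hq.1]) (kr_nonneg (by linarith) hq.1.le)
  have hint : IntegrableOn (fun q => q * kr i q r) (Set.Ioc r p) :=
    intervalIntegral.integrableOn_deriv_of_nonneg hcont hder hpos
  have hzero : ∀ q ∈ Set.Ioc a r, q * kr i q r = 0 := by
    intro q hq
    rw [kr_zero (by linarith [hq.1]) hq.2, mul_zero]
  have hint0 : IntegrableOn (fun q => q * kr i q r) (Set.Ioc a r) :=
    (integrableOn_zero).congr_fun (fun q hq => (hzero q hq).symm) measurableSet_Ioc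
  have hU : Set.Ioc a p = Set.Ioc a r ∪ Set.Ioc r p := (Set.Ioc_union_Ioc_eq_Ioc har hrp).symm
  refine ⟨by rw [hU]; exact hint0.union hint, ?_⟩
  rw [hU, setIntegral_union (Set.Ioc_disjoint_Ioc_of_le le_rfl) measurableSet_Ioc hint0 hint,
    setIntegral_congr_fun measurableSet_Ioc hzero]
  rw [← intervalIntegral.integral_of_le hrp,
    intervalIntegral.integral_eq_sub_of_hasDerivAt_of_le hrp hcont hder
      ((intervalIntegrable_iff_integrableOn_Ioc_of_le hrp).mpr hint), kr_succ i r r]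
  simp

lemma kr_ftc_r {a p : ℝ} (ha : 0 ≤ a) (hap : a ≤ p) :
    IntegrableOn (fun r => r * kr 0 p r) (Set.Ioc a p) ∧
    ∫ r in Set.Ioc a p, r * kr 0 p r = kr 1 p a := by
  have hcont : ContinuousOn (fun r => - kr 1 p r) (Set.Icc a p) := by
    have := kr_continuous_succ 0
    have h2 : Continuous (fun q => kr (0+1) p q) := this.comp (by fun_prop : Continuous fun q : ℝ => (p, q))
    exact h2.neg.continuousOn
  have hder : ∀ q ∈ Set.Ioo a p, HasDerivAt (fun r => - kr 1 p r) (q * kr 0 p q) q := by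
    intro q hq
    exact kr_hasDeriv_r (by nlinarith [hq.1, hq.2])
  have hpos : ∀ q ∈ Set.Ioo a p, 0 ≤ q * kr 0 p q := by
    intro q hq
    exact mul_nonneg (by linarith [hq.1]) (kr_nonneg (by linarith [hq.1]) hq.2.le)
  have hint : IntegrableOn (fun r => r * kr 0 p r) (Set.Ioc a p) :=
    intervalIntegral.integrableOn_deriv_of_nonneg hcont hder hpos
  refine ⟨hint, ?_⟩
  rw [← intervalIntegral.integral_of_le hap,
    intervalIntegral.integral_eq_sub_of_hasDerivAt_of_le hap hcont hder
      ((intervalIntegrable_iff_integrableOn_Ioc_of_le hap).mpr hint), kr_succ 0 p p]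
  simp

lemma kr_int_r (g : ℝ → ℝ) (hg : Continuous g) (i : ℕ) {a p : ℝ} (ha : 0 < a) (hap : a ≤ p) :
    IntegrableOn (fun r => g r * kr i p r) (Set.Ioc a p) := by
  have h := (kr_ftc_r ha.le hap).1
  have hc : Continuous (fun r => g r * (p^2-r^2)^i) := by fun_prop
  have hc2 : ContinuousOn (fun r => g r * (p^2-r^2)^i / r) (Set.Icc a p) :=
    hc.continuousOn.div continuousOn_id (fun r hr => by have := hr.1; simp; linarith)
  rw [← integrableOn_Icc_iff_integrableOn_Ioc] at h ⊢
  refine (h.continuousOn_mul hc2 isCompact_Icc).congr_fun (fun r hr => ?_) measurableSet_Icc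
  have : r ≠ 0 := by have := hr.1; linarith
  simp only [kr]
  field_simp

def JJ (g : ℝ → ℝ) (a : ℝ) (i : ℕ) (p : ℝ) : ℝ := ∫ r in a..p, g r * kr i p r

lemma JJ_bound (g : ℝ → ℝ) (hg : Continuous g) {a b : ℝ} (ha : 0 < a) :
    ∃ B, ∀ p ∈ Set.Icc a b, |JJ g a 0 p| ≤ B := by
  obtain ⟨Cg, hC⟩ := isCompact_Icc.exists_bound_of_continuousOn (hg.continuousOn (s := Set.Icc a b))
  have hK : ContinuousOn (fun p => kr 1 p a) (Set.Icc a b) :=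
    ((kr_continuous_succ 0).comp (by fun_prop : Continuous fun q : ℝ => (q, a))).continuousOn
  obtain ⟨D, hD⟩ := isCompact_Icc.exists_bound_of_continuousOn hK
  refine ⟨Cg / a * D, fun p hp => ?_⟩
  have hCnn : 0 ≤ Cg := (norm_nonneg _).trans (hC p hp)
  obtain ⟨h1, h2⟩ := kr_ftc_r ha.le hp.1
  unfold JJ
  rw [intervalIntegral.integral_of_le hp.1]
  have h3 : ‖∫ r in Set.Ioc a p, g r * kr 0 p r‖ ≤ ∫ r in Set.Ioc a p, Cg / a * (r * kr 0 p r) := by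
    refine norm_integral_le_of_norm_le (h1.const_mul _) ?_
    refine (ae_restrict_iff' measurableSet_Ioc).mpr (Filter.Eventually.of_forall fun r hr => ?_)
    have hk : 0 ≤ kr 0 p r := kr_nonneg (by linarith [hr.1]) hr.2
    rw [norm_mul, Real.norm_of_nonneg hk, ← mul_assoc]
    refine mul_le_mul_of_nonneg_right ((hC r ⟨hr.1.le, hr.2.trans hp.2⟩).trans ?_) hk
    rw [div_mul_eq_mul_div, le_div_iff₀ ha]
    exact mul_le_mul_of_nonneg_left hr.1.le hCnn
  rw [Real.norm_eq_abs, integral_const_mul, h2] at h3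
  refine h3.trans (mul_le_mul_of_nonneg_left ?_ (by positivity))
  exact (le_abs_self _).trans (hD p hp)

lemma JJ_rec (g : ℝ → ℝ) (hg : Continuous g) (i : ℕ) {a p : ℝ} (ha : 0 < a) (hap : a ≤ p) :
    IntervalIntegrable (fun q => q * JJ g a i q) volume a p ∧
    JJ g a (i+1) p = (2*i+1) * ∫ q in a..p, q * JJ g a i q := by
  set μ := (volume : Measure ℝ).restrict (Set.Ioc a p) with hμ
  have hmeas : AEStronglyMeasurable (fun z : ℝ × ℝ => g z.2 * (z.1 * kr i z.1 z.2)) (μ.prod μ) := by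
    have : Measurable (fun z : ℝ × ℝ => g z.2 * (z.1 * kr i z.1 z.2)) :=
      (hg.measurable.comp measurable_snd).mul (measurable_fst.mul (kr_measurable i))
    exact this.aestronglyMeasurable
  have hInt : Integrable (fun z : ℝ × ℝ => g z.2 * (z.1 * kr i z.1 z.2)) (μ.prod μ) := by
    rw [integrable_prod_iff' hmeas]
    constructor
    · refine (ae_restrict_iff' measurableSet_Ioc).mpr (Filter.Eventually.of_forall fun r hr => ?_)
      exact ((kr_ftc i ha.le hr.1.le hr.2).1).const_mul (g r)
    · have hc : Continuous (fun r => |g r| * (kr (i+1) p r / (2*i+1))) := by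
        have h2 : Continuous (fun r => kr (i+1) p r) :=
          (kr_continuous_succ i).comp (by fun_prop : Continuous fun q : ℝ => (p, q))
        fun_prop
      have hI : IntegrableOn (fun r => |g r| * (kr (i+1) p r / (2*i+1))) (Set.Ioc a p) :=
        (hc.integrableOn_Icc).mono_set Set.Ioc_subset_Icc_self
      refine hI.congr_fun (fun r hr => ?_) measurableSet_Ioc
      simp only
      rw [← (kr_ftc i ha.le hr.1.le hr.2).2, ← integral_const_mul]
      refine setIntegral_congr_fun measurableSet_Ioc fun q hq => ?_
      have hk : 0 ≤ q * kr i q r := by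
        rcases le_total r q with h | h
        · exact mul_nonneg (by linarith [hq.1]) (kr_nonneg (by linarith [hr.1]) h)
        · rw [kr_zero (by linarith [hq.1]) h]; simp
      simp only [norm_mul (g r), Real.norm_eq_abs, abs_of_nonneg hk]
  have hinner : ∀ q ∈ Set.Ioc a p, ∫ r, g r * (q * kr i q r) ∂μ = q * JJ g a i q := by
    intro q hq
    unfold JJ
    rw [intervalIntegral.integral_of_le hq.1.le, ← integral_const_mul]
    have : ∀ r, g r * (q * kr i q r) = q * (g r * kr i q r) := fun r => by ring
    simp only [this, hμ]
    refine setIntegral_eq_of_subset_of_forall_sdiff_eq_zero measurableSet_Ioc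
      (Set.Ioc_subset_Ioc_right hq.2) ?_
    intro r hr
    have : q ≤ r := by
      by_contra hlt
      exact hr.2 ⟨hr.1.1, (not_le.mp hlt).le⟩
    rw [kr_zero (by linarith [hq.1]) this]; simp
  constructor
  · rw [intervalIntegrable_iff_integrableOn_Ioc_of_le hap]
    exact (show IntegrableOn _ _ _ from hInt.integral_prod_left).congr_fun (fun q hq => hinner q hq) measurableSet_Ioc
  · have hswap := integral_integral_swap (f := fun q r => g r * (q * kr i q r)) hInt
    rw [intervalIntegral.integral_of_le hap]
    have e1 : ∫ q in Set.Ioc a p, q * JJ g a i q = ∫ q, ∫ r, g r * (q * kr i q r) ∂μ ∂μ :=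
      setIntegral_congr_fun measurableSet_Ioc fun q hq => (hinner q hq).symm
    rw [e1, hswap]
    unfold JJ
    rw [intervalIntegral.integral_of_le hap, ← integral_const_mul]
    refine setIntegral_congr_fun measurableSet_Ioc fun r hr => ?_
    rw [integral_const_mul, (kr_ftc i ha.le hr.1.le hr.2).2]
    have : (2*(i:ℝ)+1) ≠ 0 := by positivity
    field_simp

lemma moment (g : ℝ → ℝ) (hg : Continuous g) {a b : ℝ} (ha : 0 < a) (hab : a < b)
    (h : ∀ i, JJ g a (i+1) b = 0) : ∀ r ∈ Set.Icc a b, g r = 0 := by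
  set φ : ℝ → ℝ := fun r => g r * Real.sqrt (b^2-r^2) with hφ
  have hφc : Continuous φ := by fun_prop
  have hm : ∀ i, ∫ r in a..b, φ r * (b^2-r^2)^i = 0 := by
    intro i
    rw [← h i]
    unfold JJ
    refine intervalIntegral.integral_congr fun r _ => ?_
    simp only [kr_succ, hφ]; ring
  have hpoly : ∀ q : Polynomial ℝ, ∫ r in a..b, φ r * q.eval (b^2-r^2) = 0 := by
    intro q
    simp only [Polynomial.eval_eq_sum_range, Finset.mul_sum]
    rw [intervalIntegral.integral_finsetSum]
    · refine Finset.sum_eq_zero fun i _ => ?_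
      have : ∀ r, φ r * (q.coeff i * (b^2-r^2)^i) = q.coeff i * (φ r * (b^2-r^2)^i) :=
        fun r => by ring
      simp only [this, intervalIntegral.integral_const_mul, hm, mul_zero]
    · intro i _
      exact Continuous.intervalIntegrable (by fun_prop) _ _
  have hsq : ∫ r in a..b, φ r * φ r = 0 := by
    obtain ⟨Cφ, hC⟩ := isCompact_Icc.exists_bound_of_continuousOn (hφc.continuousOn (s := Set.Icc a b))
    have hCn : 0 ≤ Cφ := (norm_nonneg _).trans (hC a ⟨le_rfl, hab.le⟩)
    have key : ∀ ε > 0, |∫ r in a..b, φ r * φ r| ≤ Cφ * ε * (b - a) := by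
      intro ε hε
      obtain ⟨q, hq⟩ := exists_polynomial_near_of_continuousOn 0 (b^2-a^2)
        (fun z => φ (Real.sqrt (b^2-z))) (by fun_prop) ε hε
      have e : ∫ r in a..b, φ r * φ r = ∫ r in a..b, φ r * (φ r - q.eval (b^2-r^2)) := by
        simp only [mul_sub]
        rw [intervalIntegral.integral_sub, hpoly q, sub_zero]
        · exact Continuous.intervalIntegrable (by fun_prop) _ _
        · exact Continuous.intervalIntegrable (by fun_prop) _ _
      rw [e, ← Real.norm_eq_abs]
      have := intervalIntegral.norm_integral_le_of_norm_le_const (a := a) (b := b) (C := Cφ * ε)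
        (f := fun r => φ r * (φ r - q.eval (b^2-r^2))) ?_
      · rwa [abs_of_nonneg (by linarith)] at this
      · intro r hr
        rw [Set.uIoc_of_le hab.le] at hr
        rw [norm_mul]
        refine mul_le_mul (hC r ⟨hr.1.le, hr.2⟩) ?_ (norm_nonneg _) hCn
        have := hq (b^2-r^2) ⟨by nlinarith [hr.1, hr.2], by nlinarith [hr.1]⟩
        rw [show b^2-(b^2-r^2) = r^2 by ring, Real.sqrt_sq (by linarith [hr.1])] at this
        rw [norm_sub_rev]; exact this.le
    have : |∫ r in a..b, φ r * φ r| ≤ 0 := by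
      refine le_of_forall_pos_le_add fun ε hε => ?_
      have := key (ε / (Cφ * (b-a) + 1)) (by have : 0 ≤ Cφ * (b-a) := mul_nonneg hCn (by linarith)
                                             positivity)
      refine this.trans ?_
      have h0 : 0 ≤ Cφ * (b-a) := mul_nonneg hCn (by linarith)
      rw [zero_add, show Cφ * (ε / (Cφ * (b-a) + 1)) * (b-a) = (Cφ * (b-a)) * ε / (Cφ * (b-a) + 1) by ring,
        div_le_iff₀ (by positivity)]
      nlinarith
    exact abs_nonpos_iff.mp this
  have hz : ∀ r ∈ Set.Ioo a b, g r = 0 := by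
    intro r hr
    by_contra hne
    have hpos : 0 < ∫ r in a..b, φ r * φ r := by
      refine intervalIntegral.integral_pos hab (by fun_prop) (fun x _ => mul_self_nonneg _)
        ⟨r, ⟨hr.1.le, hr.2.le⟩, ?_⟩
      have : 0 < Real.sqrt (b^2-r^2) := Real.sqrt_pos.mpr (by nlinarith [hr.1, hr.2])
      have : φ r ≠ 0 := mul_ne_zero hne this.ne'
      exact mul_self_pos.mpr this
    linarith
  have hcl : IsClosed {r | g r = 0} := isClosed_eq hg continuous_const
  have := closure_minimal (s := Set.Ioo a b) (t := {r | g r = 0}) hz hcl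
  rw [closure_Ioo hab.ne] at this
  exact this
lemma int_poly (i : ℕ) (T p : ℝ) :
    ∫ q in T..p, q * (q^2-T^2)^i = (p^2-T^2)^(i+1) / (2*(i+1)) := by
  have hd : ∀ q ∈ Set.uIcc T p, HasDerivAt (fun q => (q^2-T^2)^(i+1) / (2*((i:ℝ)+1)))
      (q * (q^2-T^2)^i) q := by
    intro q _
    have h1 : HasDerivAt (fun q : ℝ => q^2 - T^2) (2*q) q := by
      simpa using ((hasDerivAt_id q).pow 2).sub_const (T^2)
    refine ((h1.pow (i+1)).div_const (2*((i:ℝ)+1))).congr_deriv ?_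
    have : (i:ℝ)+1 ≠ 0 := by positivity
    simp
    field_simp
  rw [intervalIntegral.integral_eq_sub_of_hasDerivAt hd
    (Continuous.intervalIntegrable (by fun_prop) _ _)]
  simp

lemma JJ_vanish (g : ℝ → ℝ) (hg : Continuous g) {a T : ℝ} (ha : 0 < a)
    (h : ∀ p ∈ Set.Icc a T, JJ g a 1 p = 0) (i : ℕ) : ∀ p ∈ Set.Icc a T, JJ g a (i+1) p = 0 := by
  induction i with
  | zero => exact h
  | succ i ih =>
    intro p hp
    rw [(JJ_rec g hg (i+1) ha hp.1).2]
    have : ∫ q in a..p, q * JJ g a (i+1) q = ∫ q in a..p, (0:ℝ) := by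
      refine intervalIntegral.integral_congr fun q hq => ?_
      rw [Set.uIcc_of_le hp.1] at hq
      rw [ih q ⟨hq.1, hq.2.trans hp.2⟩, mul_zero]
    rw [this]; simp

lemma JJ_le (g : ℝ → ℝ) (hg : Continuous g) {a T T' M : ℝ} (ha : 0 < a) (haT : a ≤ T)
    (hM0 : 0 ≤ M)
    (h : ∀ p ∈ Set.Icc a T, JJ g a 1 p = 0) (hM : ∀ p ∈ Set.Ioc T T', |JJ g a 0 p| ≤ M) (i : ℕ) :
    ∀ p ∈ Set.Ioc T T', |JJ g a (i+1) p| ≤ M / 2 * (p^2-T^2)^(i+1) := by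
  have main : ∀ (i : ℕ) (K : ℝ), (∀ p ∈ Set.Ioc T T', |JJ g a i p| ≤ K * (p^2-T^2)^i) →
      ∀ p ∈ Set.Ioc T T', |JJ g a (i+1) p| ≤ (2*i+1) * (K * ((p^2-T^2)^(i+1) / (2*(i+1)))) := by
    intro i K hK p hp
    have hap : a ≤ p := haT.trans hp.1.le
    obtain ⟨h1, h2⟩ := JJ_rec g hg i ha hap
    obtain ⟨h3, h4⟩ := JJ_rec g hg i ha haT
    have h5 : ∫ q in a..T, q * JJ g a i q = 0 := by
      have := JJ_vanish g hg ha h i T ⟨haT, le_rfl⟩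
      rw [h4] at this
      have h6 : (2*(i:ℝ)+1) ≠ 0 := by positivity
      simpa [h6] using this
    have h7 : IntervalIntegrable (fun q => q * JJ g a i q) volume T p := h3.symm.trans h1
    rw [h2, ← intervalIntegral.integral_add_adjacent_intervals h3 h7, h5, zero_add, abs_mul,
      abs_of_nonneg (by positivity : (0:ℝ) ≤ 2*i+1)]
    refine mul_le_mul_of_nonneg_left ?_ (by positivity)
    rw [← int_poly, ← intervalIntegral.integral_const_mul, ← Real.norm_eq_abs]
    refine intervalIntegral.norm_integral_le_of_norm_le hp.1.le ?_
      (Continuous.intervalIntegrable (by fun_prop) _ _)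
    refine Filter.Eventually.of_forall fun q hq => ?_
    have hq0 : 0 ≤ q := by linarith [hq.1]
    rw [norm_mul, Real.norm_of_nonneg hq0, Real.norm_eq_abs]
    calc q * |JJ g a i q| ≤ q * (K * (q^2-T^2)^i) :=
          mul_le_mul_of_nonneg_left (hK q ⟨hq.1, hq.2.trans hp.2⟩) hq0
      _ = K * (q * (q^2-T^2)^i) := by ring
  induction i with
  | zero =>
    intro p hp
    have := main 0 M (by simpa using hM) p hp
    refine this.trans (le_of_eq ?_)
    norm_num; ring
  | succ i ih =>
    intro p hp
    refine (main (i+1) (M/2) ih p hp).trans ?_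
    have hz : 0 ≤ p^2 - T^2 := by nlinarith [hp.1]
    have hz2 : 0 ≤ M / 2 * (p^2-T^2)^(i+1+1) := by positivity
    have : (2*((i+1:ℕ):ℝ)+1) * (M/2 * ((p^2-T^2)^(i+1+1) / (2*(((i+1:ℕ):ℝ)+1))))
        = (M / 2 * (p^2-T^2)^(i+1+1)) * ((2*((i+1:ℕ):ℝ)+1) / (2*(((i+1:ℕ):ℝ)+1))) := by
      field_simp
    rw [this]
    refine mul_le_of_le_one_right hz2 ?_
    rw [div_le_one (by positivity)]
    linarith

open Topology in
lemma all_vanish (g : ℝ → ℝ) (hg : Continuous g) {a b : ℝ} (ha : 0 < a) (hab : a < b)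
    (N : ℕ) (e : ℕ → ℝ → ℝ)
    (heq : ∀ p ∈ Set.Icc a b, ∑ i ∈ Finset.range (N+1), e i p * JJ g a i p = 0)
    (hloc : ∀ T ∈ Set.Ico a b, ∀ᶠ p in 𝓝[>] T, e 0 p ≠ 0 ∧
      ∑ i ∈ Finset.range N, |e (i+1) p| * (p^2-T^2)^(i+1) ≤ 3/2 * |e 0 p|) :
    ∀ p ∈ Set.Icc a b, JJ g a 1 p = 0 := by
  obtain ⟨B, hB⟩ := JJ_bound g hg (b := b) ha
  have hB0 : 0 ≤ B := (abs_nonneg _).trans (hB a ⟨le_rfl, hab.le⟩)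
  have hJc : ContinuousOn (JJ g a 1) (Set.Icc a b) := by
    have h1 := (JJ_rec g hg 0 ha hab.le).1
    have h2 := intervalIntegral.continuousOn_primitive_interval
      (((intervalIntegrable_iff_integrableOn_Icc_of_le hab.le).mp h1).mono_set
        (by rw [Set.uIcc_of_le hab.le]))
    rw [Set.uIcc_of_le hab.le] at h2
    refine h2.congr fun p hp => ?_
    have := (JJ_rec g hg 0 ha hp.1).2
    simpa using this
  have hHc : Continuous (fun p => JJ g a 1 (max a (min b p))) := by
    refine hJc.comp_continuous (by fun_prop) fun p => ⟨le_max_left _ _, ?_⟩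
    exact max_le hab.le (min_le_left _ _)
  set S : Set ℝ := {T | ∀ p ∈ Set.Icc a b, JJ g a 1 (max a (min b (min p T))) = 0} with hS
  have hScl : IsClosed S := by
    have : S = ⋂ p ∈ Set.Icc a b, {T | JJ g a 1 (max a (min b (min p T))) = 0} := by
      ext T; simp [hS]
    rw [this]
    refine isClosed_biInter fun p _ => isClosed_eq ?_ continuous_const
    exact hHc.comp (by fun_prop : Continuous fun T : ℝ => min p T)
  have hSmem : ∀ T ∈ Set.Icc a b, T ∈ S ↔ ∀ p ∈ Set.Icc a T, JJ g a 1 p = 0 := by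
    intro T hT
    constructor
    · intro h p hp
      have := h p ⟨hp.1, hp.2.trans hT.2⟩
      rwa [min_eq_left hp.2, min_eq_right (hp.2.trans hT.2), max_eq_right hp.1] at this
    · intro h p hp
      have h1 : a ≤ min p T := le_min hp.1 hT.1
      rw [min_eq_right ((min_le_right _ _).trans hT.2), max_eq_right h1]
      exact h _ ⟨h1, min_le_right _ _⟩
  have haS : a ∈ S := by
    rw [hSmem a ⟨le_rfl, hab.le⟩]
    intro p hp
    have : p = a := le_antisymm hp.2 hp.1
    rw [this]; simp [JJ]
  have hsub : Set.Icc a b ⊆ S := by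
    refine IsClosed.Icc_subset_of_forall_exists_gt (hScl.inter isClosed_Icc) haS ?_
    rintro T ⟨hTS, hT⟩ y hy
    have hTv := (hSmem T ⟨hT.1, hT.2.le⟩).mp hTS
    obtain ⟨u, hu, hus⟩ := mem_nhdsGT_iff_exists_Ioc_subset.mp (hloc T hT)
    set T' := min u (min y b) with hT'
    have hTT' : T < T' := lt_min hu (lt_min hy hT.2)
    have hT'b : T' ≤ b := (min_le_right _ _).trans (min_le_right _ _)
    refine ⟨T', ?_, hTT', (min_le_right _ _).trans (min_le_left _ _)⟩
    have hcontr : ∀ M, 0 ≤ M → (∀ p ∈ Set.Ioc T T', |JJ g a 0 p| ≤ M) →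
        ∀ p ∈ Set.Ioc T T', |JJ g a 0 p| ≤ 3/4 * M := by
      intro M hM0 hM p hp
      obtain ⟨hne, hle⟩ := hus ⟨hp.1, hp.2.trans (min_le_left _ _)⟩
      have h1 := heq p ⟨hT.1.trans hp.1.le, hp.2.trans hT'b⟩
      rw [Finset.sum_range_succ'] at h1
      have h2 : |e 0 p| * |JJ g a 0 p| ≤ |e 0 p| * (3/4 * M) := by
        rw [← abs_mul, show e 0 p * JJ g a 0 p
          = - ∑ i ∈ Finset.range N, e (i+1) p * JJ g a (i+1) p by linarith, abs_neg]
        calc |∑ i ∈ Finset.range N, e (i+1) p * JJ g a (i+1) p|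
            ≤ ∑ i ∈ Finset.range N, |e (i+1) p * JJ g a (i+1) p| :=
              Finset.abs_sum_le_sum_abs _ _
          _ ≤ ∑ i ∈ Finset.range N, (M/2) * (|e (i+1) p| * (p^2-T^2)^(i+1)) := by
              refine Finset.sum_le_sum fun i _ => ?_
              rw [abs_mul]
              have := JJ_le g hg ha hT.1 hM0 hTv hM i p hp
              calc _ ≤ |e (i+1) p| * (M / 2 * (p^2-T^2)^(i+1)) :=
                    mul_le_mul_of_nonneg_left this (abs_nonneg _)
                _ = _ := by ring
          _ = (M/2) * ∑ i ∈ Finset.range N, (|e (i+1) p| * (p^2-T^2)^(i+1)) := by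
              rw [Finset.mul_sum]
          _ ≤ (M/2) * (3/2 * |e 0 p|) := mul_le_mul_of_nonneg_left hle (by positivity)
          _ = _ := by ring
      exact le_of_mul_le_mul_left h2 (abs_pos.mpr hne)
    have hit : ∀ n : ℕ, ∀ p ∈ Set.Ioc T T', |JJ g a 0 p| ≤ (3/4)^n * B := by
      intro n
      induction n with
      | zero => intro p hp; simpa using hB p ⟨hT.1.trans hp.1.le, hp.2.trans hT'b⟩
      | succ n ih =>
        intro p hp
        have := hcontr _ (by positivity) ih p hp
        rw [pow_succ]; linarith
    have hJ0 : ∀ p ∈ Set.Ioc T T', |JJ g a 0 p| ≤ 0 := by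
      intro p hp
      have ht : Filter.Tendsto (fun n : ℕ => (3/4:ℝ)^n * B) Filter.atTop (𝓝 (0 * B)) :=
        (tendsto_pow_atTop_nhds_zero_of_lt_one (by norm_num) (by norm_num)).mul_const B
      rw [zero_mul] at ht
      exact ge_of_tendsto' ht fun n => hit n p hp
    rw [hSmem T' ⟨hT.1.trans hTT'.le, hT'b⟩]
    intro p hp
    rcases le_or_gt p T with h | h
    · exact hTv p ⟨hp.1, h⟩
    · have := JJ_le g hg ha hT.1 le_rfl hTv hJ0 0 p ⟨h, hp.2⟩
      simpa using this
  exact (hSmem b ⟨hab.le, le_rfl⟩).mp (hsub ⟨hab.le, le_rfl⟩)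

open Topology in
lemma loc_reg (e : ℕ → ℝ → ℝ) (N : ℕ) (T : ℝ) (hc : ∀ i, ContinuousAt (e i) T)
    (h0 : e 0 T ≠ 0) : ∀ᶠ p in 𝓝[>] T, e 0 p ≠ 0 ∧
      ∑ i ∈ Finset.range N, |e (i+1) p| * (p^2-T^2)^(i+1) ≤ 3/2 * |e 0 p| := by
  refine Filter.Eventually.filter_mono nhdsWithin_le_nhds ?_
  have h1 : ContinuousAt (fun p => ∑ i ∈ Finset.range N, |e (i+1) p| * (p^2-T^2)^(i+1)) T := by
    refine tendsto_finsetSum _ fun i _ => ?_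
    exact (hc (i+1)).abs.mul (by fun_prop)
  have h2 : ContinuousAt (fun p => 3/2 * |e 0 p|) T := (hc 0).abs.const_mul _
  have h3 := ContinuousAt.eventually_lt h1 h2 (by simp [h0])
  filter_upwards [h3, (hc 0).eventually_ne h0] with p hp hp2
  exact ⟨hp2, hp.le⟩

open Topology in
lemma loc_sing (e : ℕ → ℝ → ℝ) (N : ℕ) (T d : ℝ) (hc : ∀ i, ContinuousAt (e i) T)
    (h0 : e 0 T = 0) (hd : HasDerivAt (e 0) d T) (hd0 : d ≠ 0)
    (h1 : |e 1 T| * (2*T) = |d|) : ∀ᶠ p in 𝓝[>] T, e 0 p ≠ 0 ∧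
      ∑ i ∈ Finset.range (N+1), |e (i+1) p| * (p^2-T^2)^(i+1) ≤ 3/2 * |e 0 p| := by
  have hs : Filter.Tendsto (slope (e 0) T) (𝓝[>] T) (𝓝 d) :=
    (hasDerivAt_iff_tendsto_slope.mp hd).mono_left
      (nhdsWithin_mono _ fun x hx => ne_of_gt hx)
  have hΨ : ContinuousAt (fun p => ∑ i ∈ Finset.range (N+1),
      |e (i+1) p| * ((p+T)^(i+1) * (p-T)^i)) T := by
    refine tendsto_finsetSum _ fun i _ => ?_
    exact (hc (i+1)).abs.mul (by fun_prop)
  have hΨ' : Filter.Tendsto (fun p => ∑ i ∈ Finset.range (N+1),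
      |e (i+1) p| * ((p+T)^(i+1) * (p-T)^i)) (𝓝[>] T) (𝓝 |d|) := by
    have := hΨ.tendsto.mono_left (nhdsWithin_le_nhds (s := Set.Ioi T))
    rw [Finset.sum_range_succ'] at this
    simp only [sub_self] at this
    rw [← h1]
    convert this using 2
    simp; ring_nf; simp
  have hlt := hΨ'.eventually_lt (hs.abs.const_mul (3/2)) (by
    have := abs_pos.mpr hd0
    linarith)
  filter_upwards [hlt, hs.eventually_ne hd0, self_mem_nhdsWithin] with p hp hp2 hpT
  have hpT' : 0 < p - T := sub_pos.mpr hpT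
  rw [slope_def_field, h0, sub_zero] at hp hp2
  refine ⟨fun h => hp2 (by rw [h]; simp), ?_⟩
  rw [abs_div, abs_of_pos hpT', ← mul_div_assoc, lt_div_iff₀ hpT', Finset.sum_mul] at hp
  refine le_trans (le_of_eq ?_) hp.le
  refine Finset.sum_congr rfl fun i _ => ?_
  rw [show p^2-T^2 = (p+T)*(p-T) by ring, mul_pow]; ring
lemma Kalg_eform (R : ℝ) (l : ℕ) (p r : ℝ) (hR : 0 < R) (hp : R < p) (hr : 0 < r) (hrp : r < p) :
    Kalg R l p r / Real.sqrt (p - r) = 2 * π * p / R * r / Real.sqrt (p^2-r^2) *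
      eform l (R/p) (Real.sqrt (p^2-R^2)/p) (r/p) (Real.sqrt (p^2-r^2)/p) := by
  have hp0 : 0 < p := hR.trans hp
  have hs : 0 < Real.sqrt (p - r) := Real.sqrt_pos.mpr (by linarith)
  have ht : 0 < Real.sqrt (p + r) := Real.sqrt_pos.mpr (by linarith)
  have hW : Real.sqrt (p^2-r^2) = Real.sqrt (p+r) * Real.sqrt (p-r) := by
    rw [← Real.sqrt_mul (by linarith)]; congr 1; ring
  have e1 : Q3 R p r * Real.sqrt (p-r) + (-1) * Q4 R p r
      = -(R/p * (r/p) - Real.sqrt (p^2-R^2)/p * (Real.sqrt (p^2-r^2)/p)) := by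
    rw [hW, Q3, Q4]; field_simp; ring
  have e2 : Q3 R p r * Real.sqrt (p-r) + 1 * Q4 R p r
      = R/p * (r/p) + Real.sqrt (p^2-R^2)/p * (Real.sqrt (p^2-r^2)/p) := by
    rw [hW, Q3, Q4]; field_simp; ring
  unfold Kalg
  rw [Finset.sum_pair (by norm_num), e1, e2, legP_eq, legP_eq, legL_eval_neg, eform]
  have h1 : ((-1:ℝ)^l) * (-1)^l = 1 := by rw [← mul_pow]; norm_num
  generalize (legL l).eval (R/p * (r/p) - Real.sqrt (p^2-R^2)/p * (Real.sqrt (p^2-r^2)/p)) = A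
  generalize (legL l).eval (R/p * (r/p) + Real.sqrt (p^2-R^2)/p * (Real.sqrt (p^2-r^2)/p)) = D
  rw [show (-1)^l * (Q1 R p r - -1 * Q2 p r * Real.sqrt (p-r)) * ((-1)^l * A)
    = (((-1:ℝ)^l) * (-1)^l) * ((Q1 R p r + Q2 p r * Real.sqrt (p-r)) * A) by ring, h1, hW, Q1, Q2]
  have ht2 : Real.sqrt (p+r)^2 = p + r := Real.sq_sqrt (by linarith)
  have hs2 : Real.sqrt (p-r)^2 = p - r := Real.sq_sqrt (by linarith)
  field_simp
  simp only [one_pow]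
  ring

def eR (Q : Polynomial CC) (R : ℝ) (i : ℕ) (p : ℝ) : ℝ :=
  (Q.coeff i) (R/p, Real.sqrt (p^2-R^2)/p) / (p^2)^i

open Polynomial in
lemma kernel_rep (R : ℝ) (l : ℕ) (hR : 0 < R) (Q : Polynomial CC)
    (hQ : ∀ x y c s, c ^ 2 + s ^ 2 = 1 →
      eform l x y c s = c ^ ((l+1) % 2) * Q.eval₂ (evc x y) (s ^ 2))
    (p r : ℝ) (hp : R < p) (hr : 0 < r) (hrp : r ≤ p) :
    Kalg R l p r / Real.sqrt (p - r) = (2 * π * p / R / p ^ ((l+1)%2)) *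
      ∑ i ∈ Finset.range (Q.natDegree + 1 + 1), eR Q R i p * (r ^ ((l+1)%2+1) * kr i p r) := by
  have hp0 : 0 < p := hR.trans hp
  rcases hrp.eq_or_lt with rfl | hlt
  · simp [kr]
  have hpos : 0 < p^2-r^2 := by nlinarith
  have hW : 0 < Real.sqrt (p^2-r^2) := Real.sqrt_pos.mpr hpos
  have hW2 : Real.sqrt (p^2-r^2)^2 = p^2-r^2 := Real.sq_sqrt hpos.le
  rw [Kalg_eform R l p r hR hp hr hlt, hQ _ _ _ _ (by rw [div_pow, div_pow, hW2]; field_simp; ring),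
    eval₂_eq_sum_range' _ (show Q.natDegree < Q.natDegree + 1 + 1 by omega), Finset.mul_sum,
    Finset.mul_sum, Finset.mul_sum]
  refine Finset.sum_congr rfl fun i _ => ?_
  rw [eR, kr, evc_apply, div_pow, div_pow, div_pow, hW2]
  field_simp
  ring

open Topology Polynomial in
lemma local_cond (R : ℝ) (l : ℕ) (hR : 0 < R) (Q : Polynomial CC)
    (hQ : ∀ x y c s, c ^ 2 + s ^ 2 = 1 →
      eform l x y c s = c ^ ((l+1) % 2) * Q.eval₂ (evc x y) (s ^ 2))
    (T : ℝ) (hT : R < T) (N : ℕ) :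
    ∀ᶠ p in 𝓝[>] T, eR Q R 0 p ≠ 0 ∧
      ∑ i ∈ Finset.range (N+1), |eR Q R (i+1) p| * (p^2-T^2)^(i+1) ≤ 3/2 * |eR Q R 0 p| := by
  have hT0 : 0 < T := hR.trans hT
  have hpos : 0 < T^2-R^2 := by nlinarith
  have hw : 0 < Real.sqrt (T^2-R^2) := Real.sqrt_pos.mpr hpos
  have hw2 : Real.sqrt (T^2-R^2)^2 = T^2-R^2 := Real.sq_sqrt hpos.le
  have hcoef : ∀ x y, _ := fun x y => eform_coeffs l (Q.map (evc x y)) x y ((l+1)%2)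
    (fun c s h => by rw [hQ x y c s h, eval_map])
  simp only [coeff_map, evc_apply] at hcoef
  have hc : ∀ i, ContinuousAt (eR Q R i) T := by
    intro i
    unfold eR
    have h1 : ContinuousAt (fun p : ℝ => (R/p, Real.sqrt (p^2-R^2)/p)) T := by
      refine ContinuousAt.prodMk ?_ ?_
      · exact continuousAt_const.div continuousAt_id hT0.ne'
      · exact (by fun_prop : Continuous fun p : ℝ => Real.sqrt (p^2-R^2)).continuousAt.div
          continuousAt_id hT0.ne'
    exact ((Q.coeff i).continuous.continuousAt.comp h1).div (by fun_prop) (by positivity)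
  have he0 : eR Q R 0 = fun p => 2 * (Real.sqrt (p^2-R^2)/p) * (legL l).eval (R/p) := by
    funext p
    rw [eR, (hcoef _ _).1]; simp
  have hxy : (R/T)^2 + (Real.sqrt (T^2-R^2)/T)^2 = 1 := by
    rw [div_pow, div_pow, hw2]; field_simp; ring
  by_cases hP : (legL l).eval (R/T) = 0
  · have hP' := legL_simple l (R/T) (by
      intro h
      have : 0 < (Real.sqrt (T^2-R^2)/T)^2 := by positivity
      linarith) hP
    set P' := (derivative (legL l)).eval (R/T) with hP'd
    refine loc_sing (eR Q R) N T (2 * (Real.sqrt (T^2-R^2)/T) * (P' * (-R/T^2))) hc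
      (by rw [he0]; simp [hP]) ?_ ?_ ?_
    · rw [he0]
      have h1 : HasDerivAt (fun p : ℝ => R/p) (-R/T^2) T := by
        have := (hasDerivAt_const T R).div (hasDerivAt_id T) hT0.ne'
        refine this.congr_deriv ?_
        simp
      have h2 : HasDerivAt (fun p : ℝ => (legL l).eval (R/p)) (P' * (-R/T^2)) T :=
        ((legL l).hasDerivAt (R/T)).comp T h1
      have h3 : DifferentiableAt ℝ (fun p : ℝ => 2 * (Real.sqrt (p^2-R^2)/p)) T := by
        have h4 : DifferentiableAt ℝ (fun p : ℝ => Real.sqrt (p^2-R^2)) T :=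
          DifferentiableAt.sqrt (f := fun p : ℝ => p^2-R^2) (by fun_prop) hpos.ne'
        exact (h4.div differentiableAt_fun_id hT0.ne').const_mul 2
      refine (h3.hasDerivAt.mul h2).congr_deriv ?_
      rw [hP]; ring
    · have : -R/T^2 ≠ 0 := div_ne_zero (neg_ne_zero.mpr hR.ne') (by positivity)
      have h3 : 2 * (Real.sqrt (T^2-R^2)/T) ≠ 0 := by positivity
      exact mul_ne_zero h3 (mul_ne_zero hP' this)
    · rw [eR, (hcoef _ _).2 hP hxy]
      rw [← abs_of_pos (by positivity : 0 < 2*T), ← abs_mul, ← hP'd]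
      congr 1
      field_simp
  · refine loc_reg (eR Q R) (N+1) T hc ?_
    rw [he0]
    exact mul_ne_zero (by positivity) hP

lemma abel_side (R rm rM : ℝ) (hR : 0 < R) (hRm : R < rm) (hmM : rm < rM) (l : ℕ)
    (Q : Polynomial CC)
    (hQ : ∀ x y c s, c ^ 2 + s ^ 2 = 1 →
      eform l x y c s = c ^ ((l+1) % 2) * Q.eval₂ (evc x y) (s ^ 2))
    (f g : ℝ → ℝ) (hg : Continuous g)
    (hfg : ∀ r ∈ Set.Icc rm rM, g r = f r * r ^ ((l+1)%2+1))
    (p : ℝ) (hp : p ∈ Set.Icc rm rM) :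
    (∫ r in rm..p, f r * Kalg R l p r / Real.sqrt (p - r)) =
      (2 * π * p / R / p ^ ((l+1)%2)) *
      ∑ i ∈ Finset.range (Q.natDegree + 1 + 1), eR Q R i p * JJ g rm i p := by
  have hrm : 0 < rm := hR.trans hRm
  have h1 : (∫ r in rm..p, f r * Kalg R l p r / Real.sqrt (p - r)) =
      ∫ r in rm..p, (2 * π * p / R / p ^ ((l+1)%2)) *
      ∑ i ∈ Finset.range (Q.natDegree + 1 + 1), eR Q R i p * (g r * kr i p r) := by
    refine intervalIntegral.integral_congr fun r hr => ?_
    rw [Set.uIcc_of_le hp.1] at hr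
    rw [mul_div_assoc, kernel_rep R l hR Q hQ p r (by linarith [hp.1]) (by linarith [hr.1]) hr.2,
      hfg r ⟨hr.1, hr.2.trans hp.2⟩, Finset.mul_sum, Finset.mul_sum, Finset.mul_sum]
    refine Finset.sum_congr rfl fun i _ => ?_
    ring
  rw [h1, intervalIntegral.integral_const_mul, intervalIntegral.integral_finsetSum]
  · simp only [intervalIntegral.integral_const_mul, JJ]
  · intro i _
    refine IntervalIntegrable.const_mul ?_ _
    exact (intervalIntegrable_iff_integrableOn_Ioc_of_le hp.1).mpr (kr_int_r g hg i hrm hp.1)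

lemma JJ_sub (g₁ g₂ : ℝ → ℝ) (h₁ : Continuous g₁) (h₂ : Continuous g₂) (i : ℕ) {a p : ℝ}
    (ha : 0 < a) (hap : a ≤ p) :
    JJ (fun r => g₁ r - g₂ r) a i p = JJ g₁ a i p - JJ g₂ a i p := by
  unfold JJ
  rw [← intervalIntegral.integral_sub
    ((intervalIntegrable_iff_integrableOn_Ioc_of_le hap).mpr (kr_int_r g₁ h₁ i ha hap))
    ((intervalIntegrable_iff_integrableOn_Ioc_of_le hap).mpr (kr_int_r g₂ h₂ i ha hap))]
  simp only [sub_mul]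

lemma exists_ext {a b : ℝ} (hab : a ≤ b) (h : ℝ → ℝ) (hh : ContinuousOn h (Set.Icc a b)) :
    ∃ g : ℝ → ℝ, Continuous g ∧ ∀ r ∈ Set.Icc a b, g r = h r :=
  ⟨Set.IccExtend hab ((Set.Icc a b).domRestrict h), hh.domRestrict.Icc_extend',
    fun r hr => by rw [Set.IccExtend_of_mem hab _ hr]; rfl⟩

/-- The Abel-type equation with kernel `K_l` has at most one continuous solution on
`[r_m, r_M]`. -/
theorem abel_equation_kernel_uniqueness
    (R rm rM : ℝ) (hR : 0 < R) (hRm : R < rm) (hmM : rm < rM) (l : ℕ)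
    (f₁ f₂ : ℝ → ℝ)
    (hf₁ : ContinuousOn f₁ (Set.Icc rm rM)) (hf₂ : ContinuousOn f₂ (Set.Icc rm rM))
    (heq : ∀ p ∈ Set.Icc rm rM,
      (∫ r in rm..p, f₁ r * Kalg R l p r / Real.sqrt (p - r))
        = ∫ r in rm..p, f₂ r * Kalg R l p r / Real.sqrt (p - r)) :
    Set.EqOn f₁ f₂ (Set.Icc rm rM) := by
  have hrm : 0 < rm := hR.trans hRm
  obtain ⟨Q, hQ⟩ := good_eform l
  obtain ⟨g₁, hg₁, he₁⟩ := exists_ext hmM.le (fun r => f₁ r * r ^ ((l+1)%2+1))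
    (hf₁.mul (by fun_prop))
  obtain ⟨g₂, hg₂, he₂⟩ := exists_ext hmM.le (fun r => f₂ r * r ^ ((l+1)%2+1))
    (hf₂.mul (by fun_prop))
  have hg : Continuous (fun r => g₁ r - g₂ r) := hg₁.sub hg₂
  have hsum : ∀ p ∈ Set.Icc rm rM, ∑ i ∈ Finset.range (Q.natDegree + 1 + 1),
      eR Q R i p * JJ (fun r => g₁ r - g₂ r) rm i p = 0 := by
    intro p hp
    have hp0 : 0 < p := hrm.trans_le hp.1
    have h := heq p hp
    rw [abel_side R rm rM hR hRm hmM l Q hQ f₁ g₁ hg₁ he₁ p hp,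
      abel_side R rm rM hR hRm hmM l Q hQ f₂ g₂ hg₂ he₂ p hp] at h
    have h2 := mul_left_cancel₀ (by positivity) h
    simp only [JJ_sub g₁ g₂ hg₁ hg₂ _ hrm hp.1, mul_sub, Finset.sum_sub_distrib]
    linarith
  have hv := all_vanish (fun r => g₁ r - g₂ r) hg hrm hmM (Q.natDegree + 1) (eR Q R) hsum
    (fun T hT => local_cond R l hR Q hQ T (hRm.trans_le hT.1) Q.natDegree)
  have hm := moment (fun r => g₁ r - g₂ r) hg hrm hmM
    (fun i => JJ_vanish _ hg hrm hv i rM ⟨hmM.le, le_rfl⟩)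
  intro r hr
  have h := hm r hr
  simp only [he₁ r hr, he₂ r hr] at h
  have hr0 : r ^ ((l+1)%2+1) ≠ 0 := pow_ne_zero _ (hrm.trans_le hr.1).ne'
  exact mul_right_cancel₀ hr0 (sub_eq_zero.mp h)
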